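/- Half-line example with a surjective odd operator (Example 5.5, first case). Let Φ : ℝ → ℝ be an odd, continuous, strictly increasing, surjective operator. Then for every λ ∈ ℝ the problem ( Φ((1 + t²) x'(t)) )' = e^{−t} arctan( x(t) x'(t) ) for a.e. t ∈ [0, +∞), x(0) = 0, lim_{t→+∞} x(t) = λ, admits a solution. -/

import Mathlib

open MeasureTheory Set Filter Real

/-- The right-hand side `e^{-|s|} arctan (x x')` for `x' = ψ(v) / (1 + s²)` and `x = ∫ x'`. -/
noncomputable def arctanField (ψ v : ℝ → ℝ) (s : ℝ) : ℝ :=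
  exp (-|s|) * arctan ((∫ r in (0:ℝ)..s, ψ (v r) * (1 + r ^ 2)⁻¹) * (ψ (v s) * (1 + s ^ 2)⁻¹))

/-- Truncated delay by `h`. -/
def truncDelay (h s : ℝ) : ℝ := max (s - h) 0

/-- Picard iterates, with initial value `c`, of the integral equation delayed by `h`. -/
noncomputable def delayIterate (ψ : ℝ → ℝ) (h c : ℝ) : ℕ → ℝ → ℝ
  | 0 => fun _ => c
  | k + 1 => fun t =>
      c + ∫ s in (0:ℝ)..t, arctanField ψ (fun r => delayIterate ψ h c k (truncDelay h r)) s

lemma continuous_truncDelay (h : ℝ) : Continuous (truncDelay h) := by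
  unfold truncDelay; fun_prop

lemma truncDelay_nonneg (h s : ℝ) : 0 ≤ truncDelay h s := le_max_right _ _

lemma abs_truncDelay_sub_le (h s t : ℝ) : |truncDelay h s - truncDelay h t| ≤ |s - t| := by
  have := abs_max_sub_max_le_abs (s - h) (t - h) 0
  simpa [truncDelay] using this

lemma abs_sub_truncDelay_le {h t : ℝ} (hh : 0 ≤ h) (ht : 0 ≤ t) : |t - truncDelay h t| ≤ h := by
  unfold truncDelay
  rcases max_cases (t - h) 0 with ⟨h1, h2⟩ | ⟨h1, h2⟩ <;> rw [h1, abs_le] <;>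
    constructor <;> linarith

lemma one_add_sq_ne_zero' (t : ℝ) : 1 + t ^ 2 ≠ 0 := by positivity

lemma continuous_weighted {ψ v : ℝ → ℝ} (hψ : Continuous ψ) (hv : Continuous v) :
    Continuous fun r => ψ (v r) * (1 + r ^ 2)⁻¹ :=
  (hψ.comp hv).mul (Continuous.inv₀ (by fun_prop) one_add_sq_ne_zero')

lemma continuous_arctanField {ψ v : ℝ → ℝ} (hψ : Continuous ψ) (hv : Continuous v) :
    Continuous (arctanField ψ v) := by
  have h1 := continuous_weighted hψ hv
  have h2 : Continuous fun s => ∫ r in (0:ℝ)..s, ψ (v r) * (1 + r ^ 2)⁻¹ :=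
    intervalIntegral.continuous_primitive (fun a b => h1.intervalIntegrable a b) 0
  unfold arctanField
  exact (by fun_prop : Continuous fun s : ℝ => exp (-|s|)).mul
    (continuous_arctan.comp (h2.mul h1))

lemma abs_arctanField_le (ψ v : ℝ → ℝ) (s : ℝ) :
    |arctanField ψ v s| ≤ π / 2 * exp (-|s|) := by
  unfold arctanField
  rw [abs_mul, abs_of_pos (exp_pos _), mul_comm]
  gcongr
  exact abs_le.2 ⟨(neg_pi_div_two_lt_arctan _).le, (arctan_lt_pi_div_two _).le⟩

lemma abs_arctanField_le_pi_div_two (ψ v : ℝ → ℝ) (s : ℝ) : |arctanField ψ v s| ≤ π / 2 := by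
  refine (abs_arctanField_le ψ v s).trans (mul_le_of_le_one_right (by positivity) ?_)
  exact exp_le_one_iff.2 (neg_nonpos.2 (abs_nonneg s))

lemma abs_integral_arctanField_le (ψ v : ℝ → ℝ) {t : ℝ} (ht : 0 ≤ t) :
    |∫ s in (0:ℝ)..t, arctanField ψ v s| ≤ π / 2 := by
  have h1 : ‖∫ s in (0:ℝ)..t, arctanField ψ v s‖ ≤ ∫ s in (0:ℝ)..t, π / 2 * exp (-s) := by
    refine intervalIntegral.norm_integral_le_of_norm_le ht ?_
      (Continuous.intervalIntegrable (by fun_prop) _ _)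
    refine Eventually.of_forall fun s hs => ?_
    simpa [abs_of_pos hs.1] using abs_arctanField_le ψ v s
  have h2 : ∫ s in (0:ℝ)..t, exp (-s) = 1 - exp (-t) := by
    rw [intervalIntegral.integral_comp_neg (fun s => exp s)]; simp
  rw [intervalIntegral.integral_const_mul, h2] at h1
  refine h1.trans (mul_le_of_le_one_right (by positivity) ?_)
  linarith [exp_pos (-t)]

lemma arctanField_congr {ψ v w : ℝ → ℝ} {s : ℝ} (hs : 0 ≤ s)
    (h : ∀ r ∈ Icc 0 s, v r = w r) : arctanField ψ v s = arctanField ψ w s := by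
  unfold arctanField
  rw [h s ⟨hs, le_rfl⟩, intervalIntegral.integral_congr (g := fun r => ψ (w r) * (1 + r ^ 2)⁻¹)]
  intro r hr
  rw [uIcc_of_le hs] at hr
  simp only [h r hr]

lemma exists_eventually_weighted_bound {ι : Type*} {l : Filter ι} {ψ : ℝ → ℝ}
    (hψ : Continuous ψ) {v : ι → ℝ → ℝ} {B : ℝ}
    (hB : ∀ᶠ i in l, ∀ r, 0 ≤ r → |v i r| ≤ B) :
    ∃ M : ℝ, ∀ᶠ i in l, ∀ r, 0 ≤ r → ‖ψ (v i r) * (1 + r ^ 2)⁻¹‖ ≤ M * (1 + r ^ 2)⁻¹ := by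
  obtain ⟨M, hM⟩ := (isCompact_Icc (a := -B) (b := B)).exists_bound_of_continuousOn hψ.continuousOn
  refine ⟨M, hB.mono fun i hi r hr => ?_⟩
  rw [norm_mul, norm_of_nonneg (by positivity : (0:ℝ) ≤ (1 + r ^ 2)⁻¹)]
  gcongr
  exact hM _ (abs_le.1 (hi r hr))

lemma tendsto_arctanField {ι : Type*} {l : Filter ι} [l.IsCountablyGenerated] {ψ : ℝ → ℝ}
    (hψ : Continuous ψ) {v : ι → ℝ → ℝ} {w : ℝ → ℝ} {B : ℝ}
    (hv : ∀ i, Continuous (v i)) (hB : ∀ᶠ i in l, ∀ r, 0 ≤ r → |v i r| ≤ B)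
    (hlim : ∀ r, 0 ≤ r → Tendsto (fun i => v i r) l (nhds (w r))) {s : ℝ} (hs : 0 ≤ s) :
    Tendsto (fun i => arctanField ψ (v i) s) l (nhds (arctanField ψ w s)) := by
  obtain ⟨M, hM⟩ := exists_eventually_weighted_bound hψ hB
  have hpt : ∀ r, 0 ≤ r → Tendsto (fun i => ψ (v i r) * (1 + r ^ 2)⁻¹) l
      (nhds (ψ (w r) * (1 + r ^ 2)⁻¹)) := fun r hr =>
    ((hψ.tendsto _).comp (hlim r hr)).mul_const _
  have hint : Tendsto (fun i => ∫ r in (0:ℝ)..s, ψ (v i r) * (1 + r ^ 2)⁻¹) l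
      (nhds (∫ r in (0:ℝ)..s, ψ (w r) * (1 + r ^ 2)⁻¹)) := by
    refine intervalIntegral.tendsto_integral_filter_of_dominated_convergence
      (fun r => M * (1 + r ^ 2)⁻¹) ?_ ?_ ?_ ?_
    · exact Eventually.of_forall fun i => (continuous_weighted hψ (hv i)).aestronglyMeasurable
    · refine hM.mono fun i hi => Eventually.of_forall fun r hr => hi r ?_
      rw [uIoc_of_le hs] at hr
      exact hr.1.le
    · exact (integrable_inv_one_add_sq.const_mul M).intervalIntegrable
    · refine Eventually.of_forall fun r hr => hpt r ?_
      rw [uIoc_of_le hs] at hr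
      exact hr.1.le
  exact ((continuous_arctan.tendsto _).comp (hint.mul (hpt s hs))).const_mul _

lemma tendsto_integral_arctanField {ι : Type*} {l : Filter ι} [l.IsCountablyGenerated]
    {ψ : ℝ → ℝ} (hψ : Continuous ψ) {v : ι → ℝ → ℝ} {w : ℝ → ℝ} {B : ℝ}
    (hv : ∀ i, Continuous (v i)) (hB : ∀ᶠ i in l, ∀ r, 0 ≤ r → |v i r| ≤ B)
    (hlim : ∀ r, 0 ≤ r → Tendsto (fun i => v i r) l (nhds (w r))) {t : ℝ} (ht : 0 ≤ t) :
    Tendsto (fun i => ∫ s in (0:ℝ)..t, arctanField ψ (v i) s) l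
      (nhds (∫ s in (0:ℝ)..t, arctanField ψ w s)) := by
  refine intervalIntegral.tendsto_integral_filter_of_dominated_convergence
    (fun _ => π / 2) ?_ ?_ ?_ ?_
  · exact Eventually.of_forall fun i => (continuous_arctanField hψ (hv i)).aestronglyMeasurable
  · exact Eventually.of_forall fun i => Eventually.of_forall fun s _ =>
      abs_arctanField_le_pi_div_two ψ (v i) s
  · exact intervalIntegrable_const
  · refine Eventually.of_forall fun s hs => tendsto_arctanField hψ hv hB hlim ?_
    rw [uIoc_of_le ht] at hs
    exact hs.1.le

lemma tendsto_integral_weighted {ι : Type*} {l : Filter ι} [l.IsCountablyGenerated]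
    {ψ : ℝ → ℝ} (hψ : Continuous ψ) {v : ι → ℝ → ℝ} {w : ℝ → ℝ} {B : ℝ}
    (hv : ∀ i, Continuous (v i)) (hB : ∀ᶠ i in l, ∀ r, 0 ≤ r → |v i r| ≤ B)
    (hlim : ∀ r, 0 ≤ r → Tendsto (fun i => v i r) l (nhds (w r))) :
    Tendsto (fun i => ∫ r in Ioi (0:ℝ), ψ (v i r) * (1 + r ^ 2)⁻¹) l
      (nhds (∫ r in Ioi (0:ℝ), ψ (w r) * (1 + r ^ 2)⁻¹)) := by
  obtain ⟨M, hM⟩ := exists_eventually_weighted_bound hψ hB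
  refine tendsto_integral_filter_of_dominated_convergence
    (fun r => M * (1 + r ^ 2)⁻¹) ?_ ?_ ?_ ?_
  · exact Eventually.of_forall fun i => (continuous_weighted hψ (hv i)).aestronglyMeasurable
  · exact hM.mono fun i hi => (ae_restrict_mem measurableSet_Ioi).mono fun r hr => hi r (le_of_lt hr)
  · exact (integrable_inv_one_add_sq.const_mul M).integrableOn
  · exact (ae_restrict_mem measurableSet_Ioi).mono fun r hr =>
      ((hψ.tendsto _).comp (hlim r (le_of_lt hr))).mul_const _

lemma integrableOn_weighted {ψ v : ℝ → ℝ} (hψ : Continuous ψ) (hv : Continuous v) {B : ℝ}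
    (hB : ∀ r, 0 ≤ r → |v r| ≤ B) :
    IntegrableOn (fun r => ψ (v r) * (1 + r ^ 2)⁻¹) (Ici 0) := by
  obtain ⟨M, hM⟩ := exists_eventually_weighted_bound (l := (pure () : Filter Unit)) hψ
    (v := fun _ => v) (B := B) (by simpa using hB)
  refine ((integrable_inv_one_add_sq.const_mul M).integrableOn (s := Ici (0:ℝ))).mono'
    (continuous_weighted hψ hv).aestronglyMeasurable ?_
  exact (ae_restrict_mem measurableSet_Ici).mono fun r hr => (eventually_pure.1 hM) r hr

lemma continuous_delayIterate {ψ : ℝ → ℝ} (hψ : Continuous ψ) (h c : ℝ) (k : ℕ) :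
    Continuous (delayIterate ψ h c k) := by
  induction k with
  | zero => exact continuous_const
  | succ k ih =>
    refine continuous_const.add (intervalIntegral.continuous_primitive (fun a b => ?_) 0)
    exact (continuous_arctanField hψ (ih.comp (continuous_truncDelay h))).intervalIntegrable a b

lemma abs_delayIterate_sub_le (ψ : ℝ → ℝ) (h c : ℝ) (k : ℕ) {t : ℝ} (ht : 0 ≤ t) :
    |delayIterate ψ h c k t - c| ≤ π / 2 := by
  cases k with
  | zero => simpa [delayIterate] using pi_div_two_pos.le
  | succ k => simpa [delayIterate] using abs_integral_arctanField_le ψ _ ht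

lemma abs_delayIterate_sub_delayIterate_le {ψ : ℝ → ℝ} (hψ : Continuous ψ) (h c : ℝ) (k : ℕ)
    (s t : ℝ) :
    |delayIterate ψ h c k s - delayIterate ψ h c k t| ≤ π / 2 * |s - t| := by
  cases k with
  | zero => simp [delayIterate]; positivity
  | succ k =>
    have hc : Continuous (arctanField ψ fun r => delayIterate ψ h c k (truncDelay h r)) :=
      continuous_arctanField hψ
        ((continuous_delayIterate hψ h c k).comp (continuous_truncDelay h))
    simp only [delayIterate, add_sub_add_left_eq_sub]
    rw [intervalIntegral.integral_interval_sub_left (hc.intervalIntegrable _ _)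
      (hc.intervalIntegrable _ _)]
    rw [← Real.norm_eq_abs]
    exact intervalIntegral.norm_integral_le_of_norm_le_const fun r _ =>
      abs_arctanField_le_pi_div_two ψ _ r

lemma delayIterate_succ_eq {ψ : ℝ → ℝ} {h : ℝ} (hh : 0 ≤ h) (c : ℝ) (k : ℕ) {t : ℝ}
    (ht : 0 ≤ t) (htk : t ≤ k * h) :
    delayIterate ψ h c (k + 1) t = delayIterate ψ h c k t := by
  induction k generalizing t with
  | zero =>
    obtain rfl : t = 0 := le_antisymm (by simpa using htk) ht
    simp [delayIterate]
  | succ k ih =>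
    refine congrArg (c + ·) (intervalIntegral.integral_congr fun s hs => ?_)
    rw [uIcc_of_le ht] at hs
    refine arctanField_congr hs.1 fun r hr => ih (truncDelay_nonneg h r) ?_
    refine max_le ?_ (by positivity)
    have := hr.2.trans hs.2
    push_cast at htk
    linarith

lemma eventually_abs_delayIterate_le (ψ : ℝ → ℝ) (h c₀ : ℝ) (k : ℕ) :
    ∀ᶠ c in nhds c₀, ∀ r, 0 ≤ r →
      |delayIterate ψ h c k (truncDelay h r)| ≤ |c₀| + 1 + π / 2 := by
  filter_upwards [Metric.ball_mem_nhds c₀ one_pos] with c hc r _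
  have h1 := abs_le.1 (abs_delayIterate_sub_le ψ h c k (truncDelay_nonneg h r))
  have h2 : |c - c₀| < 1 := hc
  have h3 := abs_lt.1 h2
  refine abs_le.2 ⟨?_, ?_⟩ <;> linarith [neg_abs_le c₀, le_abs_self c₀, h1.1, h1.2, h3.1, h3.2]

lemma continuous_delayIterate_initial {ψ : ℝ → ℝ} (hψ : Continuous ψ) (h : ℝ) (k : ℕ) {t : ℝ}
    (ht : 0 ≤ t) : Continuous fun c => delayIterate ψ h c k t := by
  induction k generalizing t with
  | zero => exact continuous_id
  | succ k ih =>
    refine continuous_id.add (continuous_iff_continuousAt.2 fun c₀ => ?_)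
    refine tendsto_integral_arctanField (B := |c₀| + 1 + π / 2) hψ
      (fun c => (continuous_delayIterate hψ h c k).comp (continuous_truncDelay h)) ?_
      (fun r _ => (ih (truncDelay_nonneg h r)).tendsto c₀) ht
    exact eventually_abs_delayIterate_le ψ h c₀ k

lemma continuous_integral_delayIterate {ψ : ℝ → ℝ} (hψ : Continuous ψ) (h : ℝ) (k : ℕ) :
    Continuous fun c =>
      ∫ r in Ioi (0:ℝ), ψ (delayIterate ψ h c k (truncDelay h r)) * (1 + r ^ 2)⁻¹ := by
  refine continuous_iff_continuousAt.2 fun c₀ => ?_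
  refine tendsto_integral_weighted (B := |c₀| + 1 + π / 2) hψ
    (fun c => (continuous_delayIterate hψ h c k).comp (continuous_truncDelay h)) ?_
    (fun r _ => (continuous_delayIterate_initial hψ h k (truncDelay_nonneg h r)).tendsto c₀)
  exact eventually_abs_delayIterate_le ψ h c₀ k

lemma integral_weighted_mono {ψ v w : ℝ → ℝ} (hψ : Continuous ψ) (hmono : Monotone ψ)
    (hv : Continuous v) (hw : Continuous w) {B : ℝ} (hvB : ∀ r, 0 ≤ r → |v r| ≤ B)
    (hwB : ∀ r, 0 ≤ r → |w r| ≤ B) (hvw : ∀ r, 0 ≤ r → v r ≤ w r) :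
    ∫ r in Ioi (0:ℝ), ψ (v r) * (1 + r ^ 2)⁻¹ ≤ ∫ r in Ioi (0:ℝ), ψ (w r) * (1 + r ^ 2)⁻¹ := by
  refine setIntegral_mono_on ((integrableOn_weighted hψ hv hvB).mono_set Ioi_subset_Ici_self)
    ((integrableOn_weighted hψ hw hwB).mono_set Ioi_subset_Ici_self) measurableSet_Ioi
    fun r hr => ?_
  have := hmono (hvw r (le_of_lt hr))
  gcongr

lemma integral_weighted_const (a : ℝ) :
    ∫ r in Ioi (0:ℝ), a * (1 + r ^ 2)⁻¹ = a * (π / 2) := by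
  rw [integral_const_mul, integral_Ioi_inv_one_add_sq]; simp

lemma exists_initial_integral_delayIterate_eq {ψ : ℝ → ℝ} (hψ : Continuous ψ)
    (hmono : Monotone ψ) {lam a b : ℝ} (hab : a ≤ b) (ha : ψ a * (π / 2) ≤ lam)
    (hb : lam ≤ ψ b * (π / 2)) (h : ℝ) (k : ℕ) :
    ∃ c ∈ Icc (a - π / 2) (b + π / 2),
      ∫ r in Ioi (0:ℝ), ψ (delayIterate ψ h c k (truncDelay h r)) * (1 + r ^ 2)⁻¹ = lam := by
  have hπ := pi_pos
  have hle : a - π / 2 ≤ b + π / 2 := by linarith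
  have hcont : ∀ c, Continuous fun r => delayIterate ψ h c k (truncDelay h r) := fun c =>
    (continuous_delayIterate hψ h c k).comp (continuous_truncDelay h)
  have hdev : ∀ c r, |delayIterate ψ h c k (truncDelay h r) - c| ≤ π / 2 := fun c r =>
    abs_delayIterate_sub_le ψ h c k (truncDelay_nonneg h r)
  refine intermediate_value_Icc hle (continuous_integral_delayIterate hψ h k).continuousOn
    ⟨?_, ?_⟩
  · refine le_trans ?_ ((integral_weighted_const (ψ a)).le.trans ha)
    refine integral_weighted_mono hψ hmono (w := fun _ => a) (hcont _) continuous_const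
      (B := |a| + π) (fun r _ => ?_) (fun r _ => by linarith) fun r _ => ?_
    · have := abs_le.1 (hdev (a - π / 2) r)
      refine abs_le.2 ⟨?_, ?_⟩ <;> linarith [neg_abs_le a, le_abs_self a, this.1, this.2]
    · linarith [(abs_le.1 (hdev (a - π / 2) r)).2]
  · refine le_trans (hb.trans (integral_weighted_const (ψ b)).ge) ?_
    refine integral_weighted_mono hψ hmono (v := fun _ => b) continuous_const (hcont _)
      (B := |b| + π) (fun r _ => by linarith) (fun r _ => ?_) fun r _ => ?_
    · have := abs_le.1 (hdev (b + π / 2) r)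
      refine abs_le.2 ⟨?_, ?_⟩ <;> linarith [neg_abs_le b, le_abs_self b, this.1, this.2]
    · linarith [(abs_le.1 (hdev (b + π / 2) r)).1]

/-- Uniformly bounded, uniformly Lipschitz sequences have pointwise convergent subsequences. -/
lemma exists_subseq_tendsto_of_lipschitz {v : ℕ → ℝ → ℝ} {K B : ℝ}
    (hB : ∀ n t, |v n t| ≤ B) (hK : ∀ n s t, |v n s - v n t| ≤ K * |s - t|) :
    ∃ (u : ℝ → ℝ) (φ : ℕ → ℕ), StrictMono φ ∧ ∀ t, Tendsto (fun n => v (φ n) t) atTop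
      (nhds (u t)) := by
  have hcpt : IsCompact (univ.pi fun _ : ℚ => Icc (-B) B) :=
    isCompact_univ_pi fun _ => isCompact_Icc
  obtain ⟨a, -, φ, hφ, ha⟩ := hcpt.tendsto_subseq (x := fun n (q : ℚ) => v n q)
    fun n q _ => abs_le.1 (hB n q)
  have hq : ∀ q : ℚ, CauchySeq fun n => v (φ n) q := fun q =>
    ((tendsto_pi_nhds.1 ha) q).cauchySeq
  have hcauchy : ∀ t, CauchySeq fun n => v (φ n) t := fun t => by
    refine Metric.cauchySeq_iff.2 fun ε hε => ?_
    have hK' : 0 < |K| + 1 := by positivity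
    obtain ⟨q, hq1, hq2⟩ := exists_rat_btwn
      (show t < t + ε / 3 / (|K| + 1) by linarith [show 0 < ε / 3 / (|K| + 1) by positivity])
    obtain ⟨N, hN⟩ := Metric.cauchySeq_iff.1 (hq q) (ε / 3) (by positivity)
    have hclose : ∀ n, |v n t - v n q| < ε / 3 := fun n => by
      have h1 : |t - q| < ε / 3 / (|K| + 1) := by
        rw [abs_sub_comm, abs_of_pos (by linarith)]; linarith
      calc |v n t - v n q| ≤ K * |t - q| := hK n t q
        _ ≤ (|K| + 1) * |t - q| := by gcongr; linarith [le_abs_self K]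
        _ < (|K| + 1) * (ε / 3 / (|K| + 1)) := by gcongr
        _ = ε / 3 := by field_simp
    refine ⟨N, fun m hm n hn => ?_⟩
    have h1 := abs_lt.1 (hclose (φ m))
    have h2 := abs_lt.1 (hclose (φ n))
    have h3 := hN m hm n hn
    rw [Real.dist_eq] at h3 ⊢
    have h3 := abs_lt.1 h3
    refine abs_lt.2 ⟨?_, ?_⟩ <;> linarith [h1.1, h1.2, h2.1, h2.2, h3.1, h3.2]
  choose u hu using fun t => cauchySeq_tendsto_of_complete (hcauchy t)
  exact ⟨u, φ, hφ, hu⟩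

/-- The boundary value problem, written as an integral equation for `u = Φ(k x')`, `ψ = Φ⁻¹`. -/
lemma exists_integral_equation_solution {ψ : ℝ → ℝ} (hψ : Continuous ψ) (hmono : Monotone ψ)
    {lam a b : ℝ} (hab : a ≤ b) (ha : ψ a * (π / 2) ≤ lam) (hb : lam ≤ ψ b * (π / 2)) :
    ∃ (u : ℝ → ℝ) (B : ℝ), Continuous u ∧ (∀ t, |u t| ≤ B) ∧
      (∀ t, 0 ≤ t → u t = u 0 + ∫ s in (0:ℝ)..t, arctanField ψ u s) ∧
      ∫ r in Ioi (0:ℝ), ψ (u r) * (1 + r ^ 2)⁻¹ = lam := by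
  have hπ := pi_pos
  let h : ℕ → ℝ := fun n => ((n : ℝ) + 1)⁻¹
  have hh : ∀ n, 0 ≤ h n := fun n => by positivity
  have hh0 : Tendsto h atTop (nhds 0) := by
    simpa [h, one_div] using tendsto_one_div_add_atTop_nhds_zero_nat (𝕜 := ℝ)
  let N : ℕ → ℕ := fun n => n * (n + 1)
  choose c hc hclam using fun n =>
    exists_initial_integral_delayIterate_eq hψ hmono hab ha hb (h n) (N n)
  let U : ℕ → ℝ → ℝ := fun n => delayIterate ψ (h n) (c n) (N n)
  let v : ℕ → ℝ → ℝ := fun n t => U n (truncDelay (h n) t)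
  have hUK : ∀ n s t, |U n s - U n t| ≤ π / 2 * |s - t| := fun n s t =>
    abs_delayIterate_sub_delayIterate_le hψ _ _ _ s t
  have hvcont : ∀ n, Continuous (v n) := fun n =>
    (continuous_delayIterate hψ _ _ _).comp (continuous_truncDelay _)
  have hUeq : ∀ (n : ℕ) (t : ℝ), 0 ≤ t → t ≤ n →
      U n t = c n + ∫ s in (0:ℝ)..t, arctanField ψ (v n) s := by
    intro n t ht htn
    refine (delayIterate_succ_eq (hh n) (c n) (N n) ht (htn.trans_eq ?_)).symm
    simp only [N, h]
    push_cast
    field_simp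
  have hvB : ∀ n t, |v n t| ≤ |a| + |b| + π := fun n t => by
    have h1 := abs_le.1 (abs_delayIterate_sub_le ψ (h n) (c n) (N n) (truncDelay_nonneg (h n) t))
    have h2 := hc n
    refine abs_le.2 ⟨?_, ?_⟩ <;> simp only [v, U] <;>
      linarith [h1.1, h1.2, h2.1, h2.2, neg_abs_le a, le_abs_self b, abs_nonneg a, abs_nonneg b]
  have hvK : ∀ n s t, |v n s - v n t| ≤ π / 2 * |s - t| := fun n s t =>
    (hUK n _ _).trans
      (mul_le_mul_of_nonneg_left (abs_truncDelay_sub_le _ _ _) (by positivity))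
  obtain ⟨u, φ, hφ, hu⟩ := exists_subseq_tendsto_of_lipschitz hvB hvK
  have huK : ∀ s t, |u s - u t| ≤ π / 2 * |s - t| := fun s t =>
    le_of_tendsto ((hu s).sub (hu t)).abs (Eventually.of_forall fun n => hvK _ s t)
  have huB : ∀ t, |u t| ≤ |a| + |b| + π := fun t =>
    le_of_tendsto (hu t).abs (Eventually.of_forall fun n => hvB _ t)
  have hUlim : ∀ t, 0 ≤ t → Tendsto (fun n => U (φ n) t) atTop (nhds (u t)) := by
    intro t ht
    have hdiff : Tendsto (fun n => U (φ n) t - v (φ n) t) atTop (nhds 0) := by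
      refine squeeze_zero_norm (a := fun n => π / 2 * h (φ n)) (fun n => ?_) ?_
      · refine (hUK (φ n) _ _).trans ?_
        gcongr
        exact abs_sub_truncDelay_le (hh _) ht
      · simpa using (hh0.comp hφ.tendsto_atTop).const_mul (π / 2)
    simpa using hdiff.add (hu t)
  have hclim : Tendsto (fun n => c (φ n)) atTop (nhds (u 0)) := by
    refine (hUlim 0 le_rfl).congr fun n => ?_
    simpa using hUeq (φ n) 0 le_rfl (by positivity)
  have hvB' : ∀ᶠ n in atTop, ∀ r, 0 ≤ r → |v (φ n) r| ≤ |a| + |b| + π :=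
    Eventually.of_forall fun n r _ => hvB _ r
  refine ⟨u, |a| + |b| + π, ?_, huB, fun t ht => ?_, ?_⟩
  · exact (LipschitzWith.of_dist_le_mul (K := ⟨π / 2, by positivity⟩) huK).continuous
  · refine tendsto_nhds_unique (hUlim t ht) (Tendsto.congr' ?_ (hclim.add
      (tendsto_integral_arctanField hψ (fun n => hvcont (φ n)) hvB' (fun r _ => hu r) ht)))
    have : Tendsto (fun n => (φ n : ℝ)) atTop atTop :=
      tendsto_natCast_atTop_atTop.comp hφ.tendsto_atTop
    filter_upwards [this.eventually_ge_atTop t] with n hn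
    exact (hUeq (φ n) t ht hn).symm
  · refine tendsto_nhds_unique (tendsto_integral_weighted hψ (fun n => hvcont (φ n)) hvB'
      (fun r _ => hu r)) ?_
    exact tendsto_const_nhds.congr fun n => (hclam (φ n)).symm

open MeasureTheory Set Filter Real

/-- **Example 5.5, first case** (half-line problem with a surjective odd operator):
for any odd, continuous, strictly increasing, surjective `Φ : ℝ → ℝ`, the problem
`(Φ((1+t²)x'))' = e^{−t} arctan(x x')`, `x(0) = 0`, `x(+∞) = λ`, has a solution for every
`λ ∈ ℝ`. -/
theorem halfline_example_odd_surjective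
    (Φ : ℝ → ℝ) (hodd : ∀ s, Φ (-s) = -Φ s) (hcont : Continuous Φ)
    (hmono : StrictMono Φ) (hsurj : Function.Surjective Φ)
    (lam : ℝ) :
    ∃ x x' : ℝ → ℝ,
      IntegrableOn x' (Ici 0) ∧
      (∀ t ∈ Ici (0:ℝ), x t = ∫ s in (0:ℝ)..t, x' s) ∧
      x 0 = 0 ∧ Tendsto x atTop (nhds lam) ∧
      ∃ w : ℝ → ℝ, IntegrableOn w (Ici 0) ∧
        (∀ᵐ t ∂(volume.restrict (Ici (0:ℝ))),
          w t = Real.exp (-t) * Real.arctan (x t * x' t)) ∧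
        ∃ c : ℝ, ∀ᵐ t ∂(volume.restrict (Ici (0:ℝ))),
          Φ ((1 + t ^ 2) * x' t) = c + ∫ s in (0:ℝ)..t, w s := by

  have hπ := pi_pos
  let e := hmono.orderIsoOfSurjective Φ hsurj
  let ψ : ℝ → ℝ := e.symm
  have hψ : Continuous ψ := e.symm.continuous
  have hΦψ : ∀ y, Φ (ψ y) = y := fun y => e.apply_symm_apply y
  have hψΦ : ∀ y, ψ (Φ y) = y := fun y => e.symm_apply_apply y
  have hlam : ψ (Φ (lam / (π / 2))) * (π / 2) = lam := by
    rw [hψΦ]; field_simp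
  obtain ⟨u, B, hu, huB, hueq, hulam⟩ := exists_integral_equation_solution hψ e.symm.monotone
    le_rfl hlam.le hlam.ge
  have hint := integrableOn_weighted hψ hu fun r _ => huB r
  refine ⟨fun t => ∫ s in (0:ℝ)..t, ψ (u s) * (1 + s ^ 2)⁻¹, fun t => ψ (u t) * (1 + t ^ 2)⁻¹,
    hint, fun _ _ => rfl, by simp, ?_, arctanField ψ u, ?_, ?_, u 0, ?_⟩
  · rw [← hulam]
    exact intervalIntegral_tendsto_integral_Ioi 0 (hint.mono_set Ioi_subset_Ici_self) tendsto_id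
  · have hexp : IntegrableOn (fun s => π / 2 * exp (-s)) (Ici (0:ℝ)) :=
      ((integrableOn_Ici_iff_integrableOn_Ioi).2 (integrableOn_exp_neg_Ioi 0)).const_mul _
    refine hexp.mono' (continuous_arctanField hψ hu).aestronglyMeasurable ?_
    refine (ae_restrict_mem measurableSet_Ici).mono fun s hs => ?_
    simpa [abs_of_nonneg (mem_Ici.1 hs)] using abs_arctanField_le ψ u s
  · refine (ae_restrict_mem measurableSet_Ici).mono fun s hs => ?_
    simp only [arctanField, abs_of_nonneg (mem_Ici.1 hs)]
  · refine (ae_restrict_mem measurableSet_Ici).mono fun t ht => ?_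
    have : (1 + t ^ 2) * (ψ (u t) * (1 + t ^ 2)⁻¹) = ψ (u t) := by
      field_simp [one_add_sq_ne_zero' t]
    simp only [this, hΦψ]
    exact hueq t ht
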